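/- Let N ≥ 2, let t be a real number with 0 ≤ t < N, and let α > 0. For a measurable function u : ℝ^N → ℝ define v(x) := ((N-t)/N)^{(N-1)/N} · u(|x|^{t/(N-t)} x). Then ∫_{ℝ^N} Φ_N(α|u(y)|^{N/(N-1)}) |y|^{-t} dy = (N/(N-t)) ∫_{ℝ^N} Φ_N((N/(N-t)) α |v(x)|^{N/(N-1)}) dx, where both sides are interpreted as values in [0, ∞]. -/

import Mathlib

open MeasureTheory Real

/-- `Φ_N(τ) = Σ_{j ≥ N-1} τ^j / j!`, the exponential series with the first `N-1` terms removed. -/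
noncomputable def PhiN (N : ℕ) (τ : ℝ) : ℝ :=
  ∑' j : ℕ, τ ^ (j + (N - 1)) / (Nat.factorial (j + (N - 1)) : ℝ)

section RadialPower

variable {E : Type*} [NormedAddCommGroup E] [InnerProductSpace ℝ E]

theorem hasFDerivAt_norm_rpow_of_ne_zero {x : E} (hx : x ≠ 0) (s : ℝ) :
    HasFDerivAt (fun x : E ↦ ‖x‖ ^ s) ((s * ‖x‖ ^ (s - 2)) • innerSL ℝ x) x := by
  have h := ((hasFDerivAt_id x).norm_sq).rpow_const (p := s / 2)
    (Or.inl (by simpa using hx))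
  have hpow (y : E) (r : ℝ) : (‖y‖ ^ 2) ^ r = ‖y‖ ^ (2 * r) := by
    rw [← rpow_natCast, ← rpow_mul (norm_nonneg y), Nat.cast_ofNat]
  simp only [id_eq, hpow] at h
  convert h using 1
  · ext y
    ring_nf
  · ext y
    simp only [ContinuousLinearMap.comp_id, smul_apply, smul_eq_mul,
      nsmul_eq_mul, Nat.cast_ofNat]
    ring_nf

theorem hasFDerivAt_norm_rpow_smul {x : E} (hx : x ≠ 0) (s : ℝ) :
    HasFDerivAt (fun x : E ↦ ‖x‖ ^ s • x)
      (‖x‖ ^ s • (ContinuousLinearMap.id ℝ E +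
        ((s * ‖x‖ ^ (-2 : ℝ)) • innerSL ℝ x).smulRight x)) x := by
  have hx' : 0 < ‖x‖ := norm_pos_iff.mpr hx
  refine ((hasFDerivAt_norm_rpow_of_ne_zero hx s).fun_smul (hasFDerivAt_id x)).congr_fderiv ?_
  ext y
  simp only [smul_apply, add_apply,
    ContinuousLinearMap.id_apply, ContinuousLinearMap.smulRight_apply, smul_add, smul_smul,
    smul_eq_mul, id_eq, sub_eq_add_neg, rpow_add hx']
  ring_nf

theorem det_fderiv_norm_rpow_smul [FiniteDimensional ℝ E] {x : E} (hx : x ≠ 0) (s : ℝ) :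
    (‖x‖ ^ s • (ContinuousLinearMap.id ℝ E +
        ((s * ‖x‖ ^ (-2 : ℝ)) • innerSL ℝ x).smulRight x)).det =
      (1 + s) * ‖x‖ ^ (s * Module.finrank ℝ E) := by
  have hx' : 0 < ‖x‖ := norm_pos_iff.mpr hx
  have h : ((ContinuousLinearMap.id ℝ E +
        ((s * ‖x‖ ^ (-2 : ℝ)) • innerSL ℝ x).smulRight x : E →L[ℝ] E) : E →ₗ[ℝ] E) =
      LinearMap.transvection
        (((s * ‖x‖ ^ (-2 : ℝ)) • innerSL ℝ x : E →L[ℝ] ℝ) : E →ₗ[ℝ] ℝ) x := by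
    ext y
    simp [LinearMap.transvection]
  have hinv : ‖x‖ ^ (-2 : ℝ) * ‖x‖ ^ 2 = 1 := by
    rw [← rpow_natCast, ← rpow_add hx']
    simp
  rw [ContinuousLinearMap.det, ContinuousLinearMap.toLinearMap_smul, LinearMap.det_smul, h,
    LinearMap.transvection.det, rpow_mul hx'.le, rpow_natCast, mul_comm]
  congr 2
  simp only [ContinuousLinearMap.coe_coe, smul_apply, innerSL_apply_apply,
    real_inner_self_eq_norm_sq, smul_eq_mul]
  linear_combination s * hinv

theorem norm_norm_rpow_smul {x : E} (hx : x ≠ 0) (s : ℝ) :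
    ‖‖x‖ ^ s • x‖ = ‖x‖ ^ (1 + s) := by
  rw [norm_smul, norm_of_nonneg (by positivity), rpow_add (norm_pos_iff.mpr hx), rpow_one,
    mul_comm]

theorem norm_rpow_smul_norm_rpow_smul {x : E} (hx : x ≠ 0) (s r : ℝ) :
    ‖‖x‖ ^ s • x‖ ^ r • ‖x‖ ^ s • x = ‖x‖ ^ ((1 + s) * r + s) • x := by
  rw [norm_norm_rpow_smul hx, smul_smul, ← rpow_mul (norm_nonneg x),
    ← rpow_add (norm_pos_iff.mpr hx)]

theorem bijOn_norm_rpow_smul {s : ℝ} (hs : 1 + s ≠ 0) :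
    Set.BijOn (fun x : E ↦ ‖x‖ ^ s • x) {0}ᶜ {0}ᶜ := by
  have hmaps (r : ℝ) : Set.MapsTo (fun x : E ↦ ‖x‖ ^ r • x) {0}ᶜ {0}ᶜ := fun x hx ↦
    smul_ne_zero (rpow_pos_of_pos (norm_pos_iff.mpr hx) r).ne' hx
  have hinv : Set.InvOn (fun x : E ↦ ‖x‖ ^ (-s / (1 + s)) • x) (fun x : E ↦ ‖x‖ ^ s • x)
      {0}ᶜ {0}ᶜ := by
    constructor
    · intro x hx
      have : (1 + s) * (-s / (1 + s)) + s = 0 := by field_simp; ring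
      simp [norm_rpow_smul_norm_rpow_smul hx, this]
    · intro x hx
      have : (1 + -s / (1 + s)) * s + -s / (1 + s) = 0 := by field_simp; ring
      simp [norm_rpow_smul_norm_rpow_smul hx, this]
  exact hinv.bijOn (hmaps _) (hmaps _)

theorem lintegral_norm_rpow_smul [FiniteDimensional ℝ E] [Nontrivial E] [MeasurableSpace E]
    [BorelSpace E] (μ : Measure E) [μ.IsAddHaarMeasure] {s : ℝ} (hs : 0 < 1 + s)
    (g : E → ENNReal) :
    ∫⁻ y, g y ∂μ =
      ∫⁻ x, ENNReal.ofReal ((1 + s) * ‖x‖ ^ (s * Module.finrank ℝ E)) * g (‖x‖ ^ s • x) ∂μ := by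
  have hbij := bijOn_norm_rpow_smul (E := E) hs.ne'
  have hmeas : MeasurableSet ({0}ᶜ : Set E) := (measurableSet_singleton 0).compl
  have h := lintegral_image_eq_lintegral_abs_det_fderiv_mul μ hmeas
    (fun x hx ↦ (hasFDerivAt_norm_rpow_smul hx s).hasFDerivWithinAt) hbij.injOn g
  rw [hbij.image_eq] at h
  rw [← restrict_compl_singleton (μ := μ) (0 : E), h]
  refine setLIntegral_congr_fun hmeas fun x hx ↦ ?_
  rw [det_fderiv_norm_rpow_smul hx, abs_of_nonneg (by positivity)]

end RadialPower

/-- **Change of variables identity (2.15).** For `N ≥ 2`, `0 ≤ t < N`, `α > 0`, a measurable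
`u : ℝ^N → ℝ` and `v(x) = ((N-t)/N)^{(N-1)/N} u(|x|^{t/(N-t)} x)`, one has
`∫ Φ_N(α|u(y)|^{N/(N-1)}) |y|^{-t} dy = (N/(N-t)) ∫ Φ_N((N/(N-t))α|v(x)|^{N/(N-1)}) dx`
(as values in `[0,∞]`). -/
theorem change_of_variables_PhiN (N : ℕ) (hN : 2 ≤ N) (t : ℝ) (ht0 : 0 ≤ t)
    (htN : t < (N : ℝ)) (α : ℝ) (hα : 0 < α)
    (u : EuclideanSpace ℝ (Fin N) → ℝ) (hu : Measurable u)
    (v : EuclideanSpace ℝ (Fin N) → ℝ)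
    (hv : ∀ x, v x = (((N : ℝ) - t) / N) ^ (((N : ℝ) - 1) / N) *
      u (‖x‖ ^ (t / ((N : ℝ) - t)) • x)) :
    (∫⁻ y, ENNReal.ofReal (PhiN N (α * |u y| ^ ((N : ℝ) / ((N : ℝ) - 1))) * ‖y‖ ^ (-t)))
      = ENNReal.ofReal ((N : ℝ) / ((N : ℝ) - t)) *
        ∫⁻ x, ENNReal.ofReal
          (PhiN N (((N : ℝ) / ((N : ℝ) - t)) * α * |v x| ^ ((N : ℝ) / ((N : ℝ) - 1)))) := by
  have hN0 : (0 : ℝ) < N := by positivity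
  have hN1 : (0 : ℝ) < N - 1 := by
    have : (2 : ℝ) ≤ N := by exact_mod_cast hN
    linarith
  have hNt : 0 < (N : ℝ) - t := sub_pos.mpr htN
  have : Nonempty (Fin N) := ⟨⟨0, by omega⟩⟩
  have hs : 1 + t / ((N : ℝ) - t) = N / (N - t) := by field_simp; ring
  have hcoef (a : ℝ) : (N : ℝ) / (N - t) * α *
      |(((N : ℝ) - t) / N) ^ (((N : ℝ) - 1) / N) * a| ^ ((N : ℝ) / (N - 1)) =
        α * |a| ^ ((N : ℝ) / (N - 1)) := by
    have hexp : ((N : ℝ) - 1) / N * (N / (N - 1)) = 1 := by field_simp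
    rw [abs_mul, abs_of_nonneg (by positivity), mul_rpow (by positivity) (abs_nonneg a),
      ← rpow_mul (by positivity), hexp, rpow_one]
    field_simp
  rw [lintegral_norm_rpow_smul volume (s := t / ((N : ℝ) - t)) (by rw [hs]; positivity),
    ← lintegral_const_mul' _ _ ENNReal.ofReal_ne_top]
  refine lintegral_congr_ae ?_
  filter_upwards [Measure.ae_ne volume (0 : EuclideanSpace ℝ (Fin N))] with x hx
  have hx' : 0 < ‖x‖ := norm_pos_iff.mpr hx
  have hpow : ‖x‖ ^ (t / ((N : ℝ) - t) * N) * ‖‖x‖ ^ (t / ((N : ℝ) - t)) • x‖ ^ (-t) = 1 := by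
    rw [norm_norm_rpow_smul hx, ← rpow_mul hx'.le, ← rpow_add hx', hs]
    convert rpow_zero _ using 2
    field_simp
    ring
  rw [hv, hcoef, ← ENNReal.ofReal_mul (by rw [hs]; positivity),
    ← ENNReal.ofReal_mul (by positivity), finrank_euclideanSpace_fin, hs]
  congr 1
  linear_combination (N : ℝ) / (N - t) *
    PhiN N (α * |u (‖x‖ ^ (t / ((N : ℝ) - t)) • x)| ^ ((N : ℝ) / (N - 1))) * hpow
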